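/- arXiv:2509.12855 — 6 statements merged into one kernel-verified Lean document; each statement's English description precedes it below -/
import Mathlib

section
/- Let (X,d) be a metric space. The Fréchet distance d_F induces a metric on the set of equivalence classes of nowhere constant paths [0,1] → X: d_F(γ,σ) depends only on the equivalence classes of γ and σ, is symmetric, satisfies the triangle inequality, satisfies d_F(γ,γ) = 0, and if γ, σ are nowhere constant paths with d_F(γ,σ) = 0 then γ and σ are equivalent. -/
open Set

noncomputable section

variable {X : Type*} [MetricSpace X]

/-- `γ` is not constant on any non-trivial subinterval of `[a,b]`. -/
def NowhereConstantOn (γ : ℝ → X) (a b : ℝ) : Prop :=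
  ∀ s t : ℝ, a ≤ s → s < t → t ≤ b → ∃ u, s ≤ u ∧ u ≤ t ∧ γ u ≠ γ s

/-- A parametrization: a continuous, strictly increasing, surjective self-map of `[0,1]`. -/
def IsParam (φ : ℝ → ℝ) : Prop :=
  ContinuousOn φ (Icc 0 1) ∧ StrictMonoOn φ (Icc 0 1) ∧ φ '' Icc 0 1 = Icc 0 1

/-- Two paths `[0,1] → X` are equivalent if one is a reparametrization of the other. -/
def PathEquiv (γ σ : ℝ → X) : Prop :=
  ∃ φ : ℝ → ℝ, IsParam φ ∧ ∀ t ∈ Icc (0:ℝ) 1, γ t = σ (φ t)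

/-- The Fréchet distance of two paths `[0,1] → X`:
`inf` over pairs of parametrizations `φ, ψ` of `max_t d(γ(φ t), σ(ψ t))`. -/
def frechetDist (γ σ : ℝ → X) : ℝ :=
  sInf { r : ℝ | ∃ φ ψ : ℝ → ℝ, IsParam φ ∧ IsParam ψ ∧
    ∀ t ∈ Icc (0:ℝ) 1, dist (γ (φ t)) (σ (ψ t)) ≤ r }

open Filter Topology in
/-- A strictly increasing self-map of `[0,1]` that is onto is a parametrization. -/
theorem IsParam.of_strictMonoOn {φ : ℝ → ℝ} (hmono : StrictMonoOn φ (Icc 0 1))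
    (himg : φ '' Icc 0 1 = Icc 0 1) : IsParam φ := by
  refine ⟨?_, hmono, himg⟩
  have hmaps : MapsTo φ (Icc 0 1) (Icc 0 1) := mapsTo_iff_image_subset.2 himg.subset
  have hcont : Continuous (hmaps.restrict φ _ _) := by
    apply Monotone.continuous_of_surjective
    · intro s t hst
      exact hmono.monotoneOn s.2 t.2 hst
    · exact (MapsTo.restrict_surjective_iff hmaps).2 himg.superset
  rw [continuousOn_iff_continuous_domRestrict]
  exact continuous_subtype_val.comp hcont

namespace IsParam

variable {φ ψ : ℝ → ℝ}

theorem mapsTo (h : IsParam φ) : MapsTo φ (Icc 0 1) (Icc 0 1) :=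
  mapsTo_iff_image_subset.2 h.2.2.subset

protected theorem id : IsParam id :=
  ⟨continuousOn_id, strictMonoOn_id, image_id _⟩

theorem comp (hφ : IsParam φ) (hψ : IsParam ψ) : IsParam (φ ∘ ψ) :=
  ⟨hφ.1.comp hψ.1 hψ.mapsTo, hφ.2.1.comp hψ.2.1 hψ.mapsTo, by
    rw [image_comp, hψ.2.2, hφ.2.2]⟩

theorem exists_inverse (h : IsParam φ) :
    ∃ ψ, IsParam ψ ∧ (∀ t ∈ Icc (0 : ℝ) 1, φ (ψ t) = t) ∧ ∀ t ∈ Icc (0 : ℝ) 1, ψ (φ t) = t := by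
  have hsurj : ∀ t : ℝ, ∃ s, t ∈ Icc (0 : ℝ) 1 → s ∈ Icc (0 : ℝ) 1 ∧ φ s = t := by
    intro t
    by_cases ht : t ∈ Icc (0 : ℝ) 1
    · obtain ⟨s, hs⟩ := h.2.2.superset ht
      exact ⟨s, fun _ => hs⟩
    · exact ⟨0, fun h => absurd h ht⟩
  choose ψ hψ using hsurj
  have hleft : ∀ t ∈ Icc (0 : ℝ) 1, ψ (φ t) = t := fun t ht =>
    h.2.1.injOn (hψ _ (h.mapsTo ht)).1 ht (hψ _ (h.mapsTo ht)).2
  refine ⟨ψ, of_strictMonoOn ?_ ?_, fun t ht => (hψ t ht).2, hleft⟩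
  · intro s hs t ht hst
    rw [← h.2.1.lt_iff_lt (hψ s hs).1 (hψ t ht).1, (hψ s hs).2, (hψ t ht).2]
    exact hst
  · refine Subset.antisymm (image_subset_iff.2 fun t ht => (hψ t ht).1) fun t ht => ?_
    exact ⟨φ t, h.mapsTo ht, hleft t ht⟩

end IsParam

theorem PathEquiv.symm {Y : Type*} {γ σ : ℝ → Y} (h : PathEquiv γ σ) : PathEquiv σ γ := by
  obtain ⟨φ, hφ, heq⟩ := h
  obtain ⟨ψ, hψ, hright, -⟩ := hφ.exists_inverse
  exact ⟨ψ, hψ, fun t ht => by rw [heq _ (hψ.mapsTo ht), hright t ht]⟩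

/-- The set of bounds whose infimum is the Fréchet distance. -/
def frechetBounds (γ σ : ℝ → X) : Set ℝ :=
  {r : ℝ | ∃ φ ψ : ℝ → ℝ, IsParam φ ∧ IsParam ψ ∧
    ∀ t ∈ Icc (0 : ℝ) 1, dist (γ (φ t)) (σ (ψ t)) ≤ r}

theorem frechetDist_eq_sInf (γ σ : ℝ → X) : frechetDist γ σ = sInf (frechetBounds γ σ) := rfl

theorem frechetBounds_comm (γ σ : ℝ → X) : frechetBounds γ σ = frechetBounds σ γ := by
  ext r
  constructor
  all_goals
    rintro ⟨φ, ψ, hφ, hψ, h⟩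
    exact ⟨ψ, φ, hψ, hφ, fun t ht => by rw [dist_comm]; exact h t ht⟩

theorem frechetBounds_subset_of_pathEquiv {γ γ' σ σ' : ℝ → X} (hγ : PathEquiv γ γ')
    (hσ : PathEquiv σ σ') : frechetBounds γ σ ⊆ frechetBounds γ' σ' := by
  obtain ⟨α, hα, hγα⟩ := hγ
  obtain ⟨β, hβ, hσβ⟩ := hσ
  rintro r ⟨φ, ψ, hφ, hψ, h⟩
  refine ⟨α ∘ φ, β ∘ ψ, hα.comp hφ, hβ.comp hψ, fun t ht => ?_⟩
  rw [Function.comp_apply, Function.comp_apply, ← hγα _ (hφ.mapsTo ht), ← hσβ _ (hψ.mapsTo ht)]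
  exact h t ht

/-- It suffices to reparametrize one of the two paths. -/
theorem mem_frechetBounds_iff {γ σ : ℝ → X} {r : ℝ} :
    r ∈ frechetBounds γ σ ↔
      ∃ φ, IsParam φ ∧ ∀ t ∈ Icc (0 : ℝ) 1, dist (γ t) (σ (φ t)) ≤ r := by
  constructor
  · rintro ⟨φ, ψ, hφ, hψ, h⟩
    obtain ⟨θ, hθ, hright, -⟩ := hφ.exists_inverse
    refine ⟨ψ ∘ θ, hψ.comp hθ, fun t ht => ?_⟩
    simpa [hright t ht] using h (θ t) (hθ.mapsTo ht)
  · rintro ⟨φ, hφ, h⟩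
    exact ⟨id, φ, IsParam.id, hφ, h⟩

theorem nonneg_of_mem_frechetBounds {γ σ : ℝ → X} {r : ℝ} (hr : r ∈ frechetBounds γ σ) :
    0 ≤ r := by
  obtain ⟨φ, ψ, -, -, h⟩ := hr
  exact dist_nonneg.trans (h 0 (left_mem_Icc.2 zero_le_one))

theorem bddBelow_frechetBounds (γ σ : ℝ → X) : BddBelow (frechetBounds γ σ) :=
  ⟨0, fun _ => nonneg_of_mem_frechetBounds⟩

theorem frechetBounds_nonempty {γ σ : ℝ → X} (hγ : ContinuousOn γ (Icc 0 1))
    (hσ : ContinuousOn σ (Icc 0 1)) : (frechetBounds γ σ).Nonempty := by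
  obtain ⟨r, hr⟩ := (isCompact_Icc.image_of_continuousOn
    (continuous_dist.comp_continuousOn (hγ.prodMk hσ))).bddAbove
  exact ⟨r, id, id, IsParam.id, IsParam.id, fun t ht => hr (mem_image_of_mem _ ht)⟩

theorem frechetDist_comm (γ σ : ℝ → X) : frechetDist γ σ = frechetDist σ γ := by
  rw [frechetDist_eq_sInf, frechetBounds_comm, ← frechetDist_eq_sInf]

theorem frechetDist_congr {γ γ' σ σ' : ℝ → X} (hγ : PathEquiv γ γ') (hσ : PathEquiv σ σ') :
    frechetDist γ σ = frechetDist γ' σ' :=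
  congrArg sInf ((frechetBounds_subset_of_pathEquiv hγ hσ).antisymm
    (frechetBounds_subset_of_pathEquiv hγ.symm hσ.symm))

theorem frechetDist_self (γ : ℝ → X) : frechetDist γ γ = 0 := by
  have hmem : (0 : ℝ) ∈ frechetBounds γ γ :=
    ⟨id, id, IsParam.id, IsParam.id, fun t _ => (dist_self _).le⟩
  exact le_antisymm (csInf_le (bddBelow_frechetBounds γ γ) hmem)
    (le_csInf ⟨0, hmem⟩ fun _ => nonneg_of_mem_frechetBounds)

theorem frechetDist_triangle {γ σ ρ : ℝ → X} (hγ : ContinuousOn γ (Icc 0 1))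
    (hσ : ContinuousOn σ (Icc 0 1)) (hρ : ContinuousOn ρ (Icc 0 1)) :
    frechetDist γ ρ ≤ frechetDist γ σ + frechetDist σ ρ := by
  refine le_of_forall_pos_lt_add fun ε hε => ?_
  obtain ⟨r, hr, hrε⟩ := Real.lt_sInf_add_pos (frechetBounds_nonempty hγ hσ) (half_pos hε)
  obtain ⟨s, hs, hsε⟩ := Real.lt_sInf_add_pos (frechetBounds_nonempty hσ hρ) (half_pos hε)
  obtain ⟨φ, hφ, hφr⟩ := mem_frechetBounds_iff.1 hr
  obtain ⟨ψ, hψ, hψs⟩ := mem_frechetBounds_iff.1 hs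
  have hmem : r + s ∈ frechetBounds γ ρ :=
    mem_frechetBounds_iff.2 ⟨ψ ∘ φ, hψ.comp hφ, fun t ht =>
      (dist_triangle _ (σ (φ t)) _).trans (add_le_add (hφr t ht) (hψs _ (hφ.mapsTo ht)))⟩
  have hle : frechetDist γ ρ ≤ r + s := csInf_le (bddBelow_frechetBounds γ ρ) hmem
  rw [← frechetDist_eq_sInf] at hrε hsε
  linarith

open Filter Topology in
/-- If parametrizations `φ n` bring `σ ∘ φ n` uniformly close to a nowhere constant path `γ`, then
along any ultrafilter they converge pointwise to a strictly increasing `Φ` with `γ = σ ∘ Φ`. -/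
theorem exists_strictMonoOn_ultrafilter_limit {ι : Type*} (U : Ultrafilter ι) {γ σ : ℝ → X}
    {φ : ι → ℝ → ℝ} {ε : ι → ℝ} (hσ : ContinuousOn σ (Icc 0 1))
    (hconst : NowhereConstantOn γ 0 1) (hφ : ∀ n, IsParam (φ n)) (hε : Tendsto ε U (𝓝 0))
    (hdist : ∀ n, ∀ t ∈ Icc (0 : ℝ) 1, dist (γ t) (σ (φ n t)) ≤ ε n) :
    ∃ Φ : ℝ → ℝ, StrictMonoOn Φ (Icc 0 1) ∧ MapsTo Φ (Icc 0 1) (Icc 0 1) ∧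
      (∀ t ∈ Icc (0 : ℝ) 1, Tendsto (fun n => φ n t) U (𝓝 (Φ t))) ∧
      ∀ t ∈ Icc (0 : ℝ) 1, γ t = σ (Φ t) := by
  have hlim : ∀ t : ℝ, ∃ x, t ∈ Icc (0 : ℝ) 1 →
      x ∈ Icc (0 : ℝ) 1 ∧ Tendsto (fun n => φ n t) U (𝓝 x) := by
    intro t
    by_cases ht : t ∈ Icc (0 : ℝ) 1
    · obtain ⟨x, hx, hle⟩ := (isCompact_Icc (a := (0 : ℝ)) (b := 1)).ultrafilter_le_nhds
        (U.map fun n => φ n t)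
        (le_principal_iff.2 (Filter.mem_map.2 (Eventually.of_forall fun n => (hφ n).mapsTo ht)))
      exact ⟨x, fun _ => ⟨hx, hle⟩⟩
    · exact ⟨0, fun h => absurd h ht⟩
  choose Φ hΦ using hlim
  have heq : ∀ t ∈ Icc (0 : ℝ) 1, γ t = σ (Φ t) := by
    intro t ht
    have hto : Tendsto (fun n => φ n t) U (𝓝[Icc 0 1] (Φ t)) :=
      tendsto_nhdsWithin_iff.2 ⟨(hΦ t ht).2, Eventually.of_forall fun n => (hφ n).mapsTo ht⟩
    have hσto : Tendsto (fun n => σ (φ n t)) U (𝓝 (σ (Φ t))) :=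
      (hσ _ (hΦ t ht).1).tendsto.comp hto
    refine tendsto_nhds_unique ?_ hσto
    refine tendsto_iff_dist_tendsto_zero.2
      (squeeze_zero (fun _ => dist_nonneg) (fun n => ?_) hε)
    rw [dist_comm]
    exact hdist n t ht
  have hmono : MonotoneOn Φ (Icc 0 1) := fun s hs t ht hst =>
    le_of_tendsto_of_tendsto' (hΦ s hs).2 (hΦ t ht).2 fun n =>
      (hφ n).2.1.monotoneOn hs ht hst
  refine ⟨Φ, fun s hs t ht hst => ?_, fun t ht => (hΦ t ht).1, fun t ht => (hΦ t ht).2, heq⟩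
  refine (hmono hs ht hst.le).lt_of_ne fun hst' => ?_
  obtain ⟨u, hsu, hut, hne⟩ := hconst s t hs.1 hst ht.2
  have hu : u ∈ Icc (0 : ℝ) 1 := ⟨hs.1.trans hsu, hut.trans ht.2⟩
  have : Φ u = Φ s := ((hmono hu ht hut).trans_eq hst'.symm).antisymm (hmono hs hu hsu)
  exact hne (by rw [heq u hu, heq s hs, this])

open Filter Topology in
/-- Strictly increasing pointwise limits of mutually inverse parametrizations are inverse. -/
theorem leftInvOn_of_tendsto {ι : Type*} {l : Filter ι} [l.NeBot] {φ ψ : ι → ℝ → ℝ}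
    {Φ Ψ : ℝ → ℝ} (hφ : ∀ n, IsParam (φ n)) (hψ : ∀ n, IsParam (ψ n))
    (hinv : ∀ n, ∀ y ∈ Icc (0 : ℝ) 1, φ n (ψ n y) = y)
    (hmono : StrictMonoOn Φ (Icc 0 1)) (hΦmaps : MapsTo Φ (Icc 0 1) (Icc 0 1))
    (hΨmaps : MapsTo Ψ (Icc 0 1) (Icc 0 1))
    (hΦ : ∀ t ∈ Icc (0 : ℝ) 1, Tendsto (fun n => φ n t) l (𝓝 (Φ t)))
    (hΨ : ∀ t ∈ Icc (0 : ℝ) 1, Tendsto (fun n => ψ n t) l (𝓝 (Ψ t))) :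
    LeftInvOn Ψ Φ (Icc 0 1) := by
  intro t ht
  have hx := hΦmaps ht
  have hs := hΨmaps hx
  rcases lt_trichotomy (Ψ (Φ t)) t with hlt | heq | hgt
  · obtain ⟨u, hsu, hut⟩ := exists_between hlt
    have hu : u ∈ Icc (0 : ℝ) 1 := ⟨hs.1.trans hsu.le, hut.le.trans ht.2⟩
    refine absurd (hmono hu ht hut) (not_lt.2 (ge_of_tendsto (hΦ u hu) ?_))
    filter_upwards [(hΨ _ hx).eventually_lt_const hsu] with n hn
    exact (hinv n _ hx).symm.trans_le ((hφ n).2.1.monotoneOn ((hψ n).mapsTo hx) hu hn.le)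
  · exact heq
  · obtain ⟨u, htu, hus⟩ := exists_between hgt
    have hu : u ∈ Icc (0 : ℝ) 1 := ⟨ht.1.trans htu.le, hus.le.trans hs.2⟩
    refine absurd (hmono ht hu htu) (not_lt.2 (le_of_tendsto (hΦ u hu) ?_))
    filter_upwards [(hΨ _ hx).eventually_const_lt hus] with n hn
    exact ((hφ n).2.1.monotoneOn hu ((hψ n).mapsTo hx) hn.le).trans_eq (hinv n _ hx)

open Filter Topology in
theorem pathEquiv_of_frechetDist_eq_zero {γ σ : ℝ → X} (hγ : ContinuousOn γ (Icc 0 1))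
    (hσ : ContinuousOn σ (Icc 0 1)) (hγc : NowhereConstantOn γ 0 1)
    (hσc : NowhereConstantOn σ 0 1) (hzero : frechetDist γ σ = 0) : PathEquiv γ σ := by
  have happrox : ∀ n : ℕ, ∃ φ, IsParam φ ∧
      ∀ t ∈ Icc (0 : ℝ) 1, dist (γ t) (σ (φ t)) ≤ 1 / ((n : ℝ) + 1) := by
    intro n
    obtain ⟨r, hr, hrn⟩ := Real.lt_sInf_add_pos (frechetBounds_nonempty hγ hσ)
      (Nat.one_div_pos_of_nat (α := ℝ) (n := n))
    rw [← frechetDist_eq_sInf, hzero, zero_add] at hrn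
    obtain ⟨φ, hφ, h⟩ := mem_frechetBounds_iff.1 hr
    exact ⟨φ, hφ, fun t ht => (h t ht).trans hrn.le⟩
  choose φ hφ hφd using happrox
  choose ψ hψ hφψ hψφ using fun n => (hφ n).exists_inverse
  have hψd : ∀ n, ∀ t ∈ Icc (0 : ℝ) 1, dist (σ t) (γ (ψ n t)) ≤ 1 / ((n : ℝ) + 1) := by
    intro n t ht
    rw [dist_comm]
    simpa only [hφψ n t ht] using hφd n (ψ n t) ((hψ n).mapsTo ht)
  let U : Ultrafilter ℕ := Ultrafilter.of atTop
  have hε : Tendsto (fun n : ℕ => 1 / ((n : ℝ) + 1)) U (𝓝 0) :=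
    tendsto_one_div_add_atTop_nhds_zero_nat.mono_left (Ultrafilter.of_le _)
  obtain ⟨Φ, hΦmono, hΦmaps, hΦ, heq⟩ :=
    exists_strictMonoOn_ultrafilter_limit U hσ hγc hφ hε hφd
  obtain ⟨Ψ, hΨmono, hΨmaps, hΨ, -⟩ :=
    exists_strictMonoOn_ultrafilter_limit U hγ hσc hψ hε hψd
  have hinv : LeftInvOn Φ Ψ (Icc 0 1) :=
    leftInvOn_of_tendsto hψ hφ hψφ hΨmono hΨmaps hΦmaps hΨ hΦ
  exact ⟨Φ, .of_strictMonoOn hΦmono (hΦmaps.image_subset.antisymm (hinv.surjOn hΨmaps)), heq⟩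

/-- The Fréchet distance induces a metric on the set of equivalence classes
of nowhere constant paths `[0,1] → X`: it depends only on the equivalence classes, is
symmetric, satisfies the triangle inequality, vanishes on the diagonal, and two nowhere
constant paths at Fréchet distance `0` are equivalent. -/
theorem frechetDist_is_metric_on_classes {X : Type*} [MetricSpace X] :
    (∀ γ γ' σ σ' : ℝ → X, ContinuousOn γ (Icc 0 1) → ContinuousOn γ' (Icc 0 1) →
      ContinuousOn σ (Icc 0 1) → ContinuousOn σ' (Icc 0 1) →
      PathEquiv γ γ' → PathEquiv σ σ' → frechetDist γ σ = frechetDist γ' σ') ∧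
    (∀ γ σ : ℝ → X, ContinuousOn γ (Icc 0 1) → ContinuousOn σ (Icc 0 1) →
      frechetDist γ σ = frechetDist σ γ) ∧
    (∀ γ σ ρ : ℝ → X, ContinuousOn γ (Icc 0 1) → ContinuousOn σ (Icc 0 1) →
      ContinuousOn ρ (Icc 0 1) →
      frechetDist γ ρ ≤ frechetDist γ σ + frechetDist σ ρ) ∧
    (∀ γ : ℝ → X, ContinuousOn γ (Icc 0 1) → frechetDist γ γ = 0) ∧
    (∀ γ σ : ℝ → X, ContinuousOn γ (Icc 0 1) → ContinuousOn σ (Icc 0 1) →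
      NowhereConstantOn γ 0 1 → NowhereConstantOn σ 0 1 →
      frechetDist γ σ = 0 → PathEquiv γ σ) := by
  exact ⟨fun _ _ _ _ _ _ _ _ hγ hσ => frechetDist_congr hγ hσ,
    fun γ σ _ _ => frechetDist_comm γ σ,
    fun _ _ _ hγ hσ hρ => frechetDist_triangle hγ hσ hρ,
    fun γ _ => frechetDist_self γ,
    fun _ _ hγ hσ hγc hσc hzero => pathEquiv_of_frechetDist_eq_zero hγ hσ hγc hσc hzero⟩

end
end

section
/- Let (X,d) be a metric space and γ, σ : [0,1] → X continuous paths. Suppose that for each n ∈ ℕ there exist parametrizations φₙ, ψₙ : [0,1] → [0,1] with max_{t∈[0,1]} d(γ(φₙ(t)), σ(ψₙ(t))) < 1/n. Then there exist continuous non-decreasing maps φ, ψ : [0,1] → [0,1] with φ(0) = ψ(0) = 0, φ(1) = ψ(1) = 1 and γ ∘ φ = σ ∘ ψ. -/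
open Set

noncomputable section

variable {X : Type*} [MetricSpace X]

open Filter Topology

lemma IsParam.map_zero {φ : ℝ → ℝ} (hφ : IsParam φ) : φ 0 = 0 := by
  obtain ⟨-, hmono, himage⟩ := hφ
  have h0 : (0 : ℝ) ∈ Icc (0 : ℝ) 1 := ⟨le_rfl, zero_le_one⟩
  obtain ⟨x, hx, hx0⟩ : (0 : ℝ) ∈ φ '' Icc 0 1 := by rwa [himage]
  have h1 : φ 0 ∈ Icc (0 : ℝ) 1 := himage ▸ mem_image_of_mem φ h0
  exact le_antisymm (hx0 ▸ hmono.monotoneOn h0 hx hx.1) h1.1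

lemma IsParam.map_one {φ : ℝ → ℝ} (hφ : IsParam φ) : φ 1 = 1 := by
  obtain ⟨-, hmono, himage⟩ := hφ
  have h1 : (1 : ℝ) ∈ Icc (0 : ℝ) 1 := ⟨zero_le_one, le_rfl⟩
  obtain ⟨x, hx, hx1⟩ : (1 : ℝ) ∈ φ '' Icc 0 1 := by rwa [himage]
  have h2 : φ 1 ∈ Icc (0 : ℝ) 1 := himage ▸ mem_image_of_mem φ h1
  refine le_antisymm h2.2 ?_
  calc 1 = φ x := hx1.symm
    _ ≤ φ 1 := hmono.monotoneOn hx h1 hx.2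

/-- Two parametrizations can be jointly reparametrized so that their mean is the identity. -/
lemma IsParam.exists_add_eq_two_mul {φ ψ : ℝ → ℝ} (hφ : IsParam φ) (hψ : IsParam ψ) :
    ∃ u : ℝ → ℝ, MapsTo u (Icc 0 1) (Icc 0 1) ∧ MonotoneOn u (Icc 0 1) ∧
      ∀ t ∈ Icc (0 : ℝ) 1, φ (u t) + ψ (u t) = 2 * t := by
  have hex : ∀ t, ∃ x, t ∈ Icc (0 : ℝ) 1 → x ∈ Icc (0 : ℝ) 1 ∧ φ x + ψ x = 2 * t := by
    intro t
    by_cases ht : t ∈ Icc (0 : ℝ) 1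
    · have hivt := intermediate_value_Icc zero_le_one (hφ.1.add hψ.1)
      obtain ⟨x, hx, hxt⟩ : 2 * t ∈ (φ + ψ) '' Icc 0 1 := by
        refine hivt ⟨?_, ?_⟩
        · rw [Pi.add_apply, hφ.map_zero, hψ.map_zero]; linarith [ht.1]
        · rw [Pi.add_apply, hφ.map_one, hψ.map_one]; linarith [ht.2]
      exact ⟨x, fun _ => ⟨hx, hxt⟩⟩
    · exact ⟨0, fun h => absurd h ht⟩
  choose u hu using hex
  refine ⟨u, fun t ht => (hu t ht).1, fun s hs t ht hst => ?_, fun t ht => (hu t ht).2⟩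
  by_contra! hlt
  have h1 := hφ.2.1 (hu t ht).1 (hu s hs).1 hlt
  have h2 := hψ.2.1 (hu t ht).1 (hu s hs).1 hlt
  linarith [(hu t ht).2, (hu s hs).2]

lemma MonotoneOn.continuousOn_of_add_eq_two_mul {f g : ℝ → ℝ} {s : Set ℝ}
    (hf : MonotoneOn f s) (hg : MonotoneOn g s) (hfg : ∀ t ∈ s, f t + g t = 2 * t) :
    ContinuousOn f s := by
  refine LipschitzOnWith.continuousOn (K := 2) (LipschitzOnWith.of_le_add_mul 2 ?_)
  intro x hx y hy
  simp only [NNReal.coe_ofNat, Real.dist_eq]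
  rcases le_total x y with hxy | hxy
  · linarith [hf hx hy hxy, abs_nonneg (x - y)]
  · linarith [hg hy hx hxy, hfg x hx, hfg y hy, le_abs_self (x - y)]

lemma exists_tendsto_ultrafilter {ι : Type*} (U : Ultrafilter ι) {K : Set ℝ} (hK : IsCompact K)
    {S : Set ℝ} {f : ι → ℝ → ℝ} (hf : ∀ i, MapsTo (f i) S K) :
    ∃ g : ℝ → ℝ, ∀ t ∈ S, g t ∈ K ∧ Tendsto (fun i => f i t) U (𝓝 (g t)) := by
  have hex : ∀ t, ∃ x, t ∈ S → x ∈ K ∧ Tendsto (fun i => f i t) U (𝓝 x) := by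
    intro t
    by_cases ht : t ∈ S
    · obtain ⟨x, hx, hUx⟩ := hK.ultrafilter_le_nhds (U.map fun i => f i t)
        (tendsto_principal.2 (Eventually.of_forall fun i => hf i ht))
      exact ⟨x, fun _ => ⟨hx, hUx⟩⟩
    · exact ⟨0, fun h => absurd h ht⟩
  choose g hg using hex
  exact ⟨g, hg⟩

/-- If paths `γ, σ` admit, for each `n`, parametrizations `φₙ, ψₙ` with
`max_t d(γ(φₙ t), σ(ψₙ t)) < 1/n`, then there exist continuous non-decreasing maps
`φ, ψ : [0,1] → [0,1]` fixing `0` and `1` with `γ ∘ φ = σ ∘ ψ`. -/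
theorem exists_monotone_reparam_of_frechet_small {X : Type*} [MetricSpace X] (γ σ : ℝ → X)
    (hγ : ContinuousOn γ (Icc 0 1)) (hσ : ContinuousOn σ (Icc 0 1))
    (h : ∀ n : ℕ, 0 < n → ∃ φ ψ : ℝ → ℝ, IsParam φ ∧ IsParam ψ ∧
      ∀ t ∈ Icc (0:ℝ) 1, dist (γ (φ t)) (σ (ψ t)) < 1 / n) :
    ∃ φ ψ : ℝ → ℝ,
      ContinuousOn φ (Icc 0 1) ∧ ContinuousOn ψ (Icc 0 1) ∧
      MonotoneOn φ (Icc 0 1) ∧ MonotoneOn ψ (Icc 0 1) ∧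
      (∀ t ∈ Icc (0:ℝ) 1, φ t ∈ Icc (0:ℝ) 1 ∧ ψ t ∈ Icc (0:ℝ) 1) ∧
      φ 0 = 0 ∧ ψ 0 = 0 ∧ φ 1 = 1 ∧ ψ 1 = 1 ∧
      ∀ t ∈ Icc (0:ℝ) 1, γ (φ t) = σ (ψ t) := by
  have hseq : ∀ n : ℕ, ∃ Φ Ψ : ℝ → ℝ, MapsTo Φ (Icc 0 1) (Icc 0 1) ∧
      MapsTo Ψ (Icc 0 1) (Icc 0 1) ∧ MonotoneOn Φ (Icc 0 1) ∧ MonotoneOn Ψ (Icc 0 1) ∧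
      (∀ t ∈ Icc (0 : ℝ) 1, Φ t + Ψ t = 2 * t) ∧
      ∀ t ∈ Icc (0 : ℝ) 1, dist (γ (Φ t)) (σ (Ψ t)) ≤ 1 / ((n : ℝ) + 1) := by
    intro n
    obtain ⟨φ, ψ, hφ, hψ, hdist⟩ := h (n + 1) n.succ_pos
    obtain ⟨u, hu, humono, hsum⟩ := hφ.exists_add_eq_two_mul hψ
    refine ⟨φ ∘ u, ψ ∘ u, ?_, ?_, hφ.2.1.monotoneOn.comp humono hu,
      hψ.2.1.monotoneOn.comp humono hu, hsum, fun t ht => ?_⟩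
    · exact (mapsTo_iff_image_subset.2 hφ.2.2.subset).comp hu
    · exact (mapsTo_iff_image_subset.2 hψ.2.2.subset).comp hu
    · exact_mod_cast (hdist (u t) (hu ht)).le
  choose Φ Ψ hΦ hΨ hΦmono hΨmono hsum hdist using hseq
  let U : Ultrafilter ℕ := hyperfilter ℕ
  have hU : (U : Filter ℕ) ≤ atTop := Nat.hyperfilter_le_atTop
  obtain ⟨φ, hφ⟩ := exists_tendsto_ultrafilter U isCompact_Icc hΦ
  obtain ⟨ψ, hψ⟩ := exists_tendsto_ultrafilter U isCompact_Icc hΨ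
  have hφmono : MonotoneOn φ (Icc 0 1) := fun s hs t ht hst =>
    le_of_tendsto_of_tendsto' (hφ s hs).2 (hφ t ht).2 fun n => hΦmono n hs ht hst
  have hψmono : MonotoneOn ψ (Icc 0 1) := fun s hs t ht hst =>
    le_of_tendsto_of_tendsto' (hψ s hs).2 (hψ t ht).2 fun n => hΨmono n hs ht hst
  have hφψ : ∀ t ∈ Icc (0 : ℝ) 1, φ t + ψ t = 2 * t := fun t ht =>
    tendsto_nhds_unique ((hφ t ht).2.add (hψ t ht).2)
      (tendsto_const_nhds.congr fun n => (hsum n t ht).symm)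
  have hψφ : ∀ t ∈ Icc (0 : ℝ) 1, ψ t + φ t = 2 * t := fun t ht => by
    rw [add_comm, hφψ t ht]
  have h0 : (0 : ℝ) ∈ Icc (0 : ℝ) 1 := ⟨le_rfl, zero_le_one⟩
  have h1 : (1 : ℝ) ∈ Icc (0 : ℝ) 1 := ⟨zero_le_one, le_rfl⟩
  refine ⟨φ, ψ, hφmono.continuousOn_of_add_eq_two_mul hψmono hφψ,
    hψmono.continuousOn_of_add_eq_two_mul hφmono hψφ, hφmono, hψmono,
    fun t ht => ⟨(hφ t ht).1, (hψ t ht).1⟩, ?_, ?_, ?_, ?_, fun t ht => ?_⟩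
  · linarith [(hφ 0 h0).1.1, (hψ 0 h0).1.1, hφψ 0 h0]
  · linarith [(hφ 0 h0).1.1, (hψ 0 h0).1.1, hφψ 0 h0]
  · linarith [(hφ 1 h1).1.2, (hψ 1 h1).1.2, hφψ 1 h1]
  · linarith [(hφ 1 h1).1.2, (hψ 1 h1).1.2, hφψ 1 h1]
  · have hγt : Tendsto (fun n => γ (Φ n t)) U (𝓝 (γ (φ t))) :=
      (hγ _ (hφ t ht).1).tendsto.comp (tendsto_nhdsWithin_iff.2
        ⟨(hφ t ht).2, Eventually.of_forall fun n => hΦ n ht⟩)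
    have hσt : Tendsto (fun n => σ (Ψ n t)) U (𝓝 (σ (ψ t))) :=
      (hσ _ (hψ t ht).1).tendsto.comp (tendsto_nhdsWithin_iff.2
        ⟨(hψ t ht).2, Eventually.of_forall fun n => hΨ n ht⟩)
    exact dist_le_zero.1 (le_of_tendsto_of_tendsto' (hγt.dist hσt)
      (tendsto_one_div_add_atTop_nhds_zero_nat.mono_left hU) fun n => hdist n t ht)

end
end

section
/- Let (X,d) be a metric space, let γ, σ : [0,1] → X be nowhere constant continuous paths, and let φ, ψ : [0,1] → [0,1] be continuous non-decreasing maps with γ ∘ φ = σ ∘ ψ. Then for every non-trivial interval [t₁,t₂] ⊆ [0,1], φ is constant on [t₁,t₂] if and only if ψ is constant on [t₁,t₂]. -/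
open Set

noncomputable section

variable {X : Type*} [MetricSpace X]

/-- If `γ ∘ φ = σ ∘ ψ` with `σ` nowhere constant and `ψ` continuous and monotone, then `ψ` is
constant on every interval on which `φ` is. -/
theorem NowhereConstantOn.eq_of_comp_eq {γ σ : ℝ → X} {φ ψ : ℝ → ℝ} {t₁ t₂ : ℝ}
    (hσn : NowhereConstantOn σ 0 1) (hψc : ContinuousOn ψ (Icc t₁ t₂))
    (hψm : MonotoneOn ψ (Icc t₁ t₂)) (hψmap : ∀ t ∈ Icc t₁ t₂, ψ t ∈ Icc (0:ℝ) 1)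
    (hcomp : ∀ t ∈ Icc t₁ t₂, γ (φ t) = σ (ψ t)) (hφ : ∀ s ∈ Icc t₁ t₂, φ s = φ t₁) :
    ∀ s ∈ Icc t₁ t₂, ψ s = ψ t₁ := by
  intro s hs
  have h₁ : t₁ ∈ Icc t₁ t₂ := left_mem_Icc.2 (hs.1.trans hs.2)
  by_contra hne
  have hlt : ψ t₁ < ψ s := lt_of_le_of_ne (hψm h₁ hs hs.1) (Ne.symm hne)
  obtain ⟨u, hu₁, hu₂, hu⟩ := hσn _ _ (hψmap _ h₁).1 hlt (hψmap _ hs).2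
  obtain ⟨r, hr, rfl⟩ :=
    intermediate_value_Icc hs.1 (hψc.mono (Icc_subset_Icc_right hs.2)) ⟨hu₁, hu₂⟩
  have hr' : r ∈ Icc t₁ t₂ := ⟨hr.1, hr.2.trans hs.2⟩
  exact hu (by rw [← hcomp r hr', ← hcomp t₁ h₁, hφ r hr'])

/-- If `γ, σ` are nowhere constant paths and `φ, ψ : [0,1] → [0,1]` are
continuous non-decreasing maps with `γ ∘ φ = σ ∘ ψ`, then `φ` is constant on a non-trivial
subinterval `[t₁,t₂] ⊆ [0,1]` if and only if `ψ` is. -/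
theorem monotone_factor_constant_iff {X : Type*} [MetricSpace X] (γ σ : ℝ → X) (φ ψ : ℝ → ℝ)
    (hγc : ContinuousOn γ (Icc 0 1)) (hσc : ContinuousOn σ (Icc 0 1))
    (hγn : NowhereConstantOn γ 0 1) (hσn : NowhereConstantOn σ 0 1)
    (hφc : ContinuousOn φ (Icc 0 1)) (hψc : ContinuousOn ψ (Icc 0 1))
    (hφm : MonotoneOn φ (Icc 0 1)) (hψm : MonotoneOn ψ (Icc 0 1))
    (hφmap : ∀ t ∈ Icc (0:ℝ) 1, φ t ∈ Icc (0:ℝ) 1)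
    (hψmap : ∀ t ∈ Icc (0:ℝ) 1, ψ t ∈ Icc (0:ℝ) 1)
    (hcomp : ∀ t ∈ Icc (0:ℝ) 1, γ (φ t) = σ (ψ t)) :
    ∀ t₁ t₂ : ℝ, 0 ≤ t₁ → t₁ < t₂ → t₂ ≤ 1 →
      ((∀ s ∈ Icc t₁ t₂, φ s = φ t₁) ↔ (∀ s ∈ Icc t₁ t₂, ψ s = ψ t₁)) := by
  intro t₁ t₂ h₀ _ h₁
  have hsub : Icc t₁ t₂ ⊆ Icc 0 1 := Icc_subset_Icc h₀ h₁
  exact ⟨hσn.eq_of_comp_eq (hψc.mono hsub) (hψm.mono hsub) (fun t ht => hψmap t (hsub ht))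
      (fun t ht => hcomp t (hsub ht)),
    hγn.eq_of_comp_eq (hφc.mono hsub) (hφm.mono hsub) (fun t ht => hφmap t (hsub ht))
      (fun t ht => (hcomp t (hsub ht)).symm)⟩

end
end

section
/- Let (X,d) be a metric space, let γ, σ : [0,1] → X be nowhere constant continuous paths, and let φ, ψ : [0,1] → [0,1] be continuous, non-decreasing, surjective maps with γ ∘ φ = σ ∘ ψ. Then there exist parametrizations φ̂, ψ̂ : [0,1] → [0,1] (i.e., continuous, strictly increasing, surjective maps) with γ ∘ φ̂ = σ ∘ ψ̂. -/
open Set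

noncomputable section

variable {X : Type*} [MetricSpace X]

/-- If `φ` and `ψ` are monotone, `γ ∘ φ = σ ∘ ψ` and `σ` is nowhere constant, then `ψ` identifies
all points that `φ` identifies. -/
lemma eq_of_monotone_factor_eq {X : Type*} [MetricSpace X] {γ σ : ℝ → X} {φ ψ : ℝ → ℝ}
    (hσn : NowhereConstantOn σ 0 1) (hψc : ContinuousOn ψ (Icc 0 1))
    (hφm : MonotoneOn φ (Icc 0 1)) (hψm : MonotoneOn ψ (Icc 0 1))
    (hψmaps : MapsTo ψ (Icc 0 1) (Icc 0 1))
    (hcomp : ∀ t ∈ Icc (0:ℝ) 1, γ (φ t) = σ (ψ t)) {s t : ℝ} (hs : s ∈ Icc (0:ℝ) 1)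
    (ht : t ∈ Icc (0:ℝ) 1) (hst : s ≤ t) (h : φ s = φ t) : ψ s = ψ t := by
  have hsub : Icc s t ⊆ Icc 0 1 := Icc_subset_Icc hs.1 ht.2
  refine (hψm hs ht hst).eq_of_not_lt fun hlt => ?_
  obtain ⟨u, hu1, hu2, hu⟩ := hσn _ _ (hψmaps hs).1 hlt (hψmaps ht).2
  obtain ⟨r, hr, rfl⟩ := intermediate_value_Icc hst (hψc.mono hsub) ⟨hu1, hu2⟩
  have hr' := hsub hr
  have hφr : φ r = φ s :=
    le_antisymm (h ▸ hφm hr' ht hr.2) (hφm hs hr' hr.1)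
  exact hu (by rw [← hcomp r hr', ← hcomp s hs, hφr])

lemma MonotoneOn.continuousOn_of_image_Icc {f : ℝ → ℝ} {a b c d : ℝ}
    (hf : MonotoneOn f (Icc a b)) (himg : f '' Icc a b = Icc c d) :
    ContinuousOn f (Icc a b) := by
  have hmaps : MapsTo f (Icc a b) (Icc c d) := mapsTo_iff_image_subset.2 himg.subset
  have hmono : Monotone (hmaps.restrict f (Icc a b) (Icc c d)) :=
    fun x y hxy => hf x.2 y.2 hxy
  have hsurj : Function.Surjective (hmaps.restrict f (Icc a b) (Icc c d)) :=
    (hmaps.restrict_surjective_iff).2 himg.superset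
  rw [continuousOn_iff_continuous_domRestrict]
  exact continuous_subtype_val.comp (hmono.continuous_of_surjective hsurj)

/-- If `γ, σ` are nowhere constant paths and `φ, ψ : [0,1] → [0,1]` are
continuous, non-decreasing, surjective maps with `γ ∘ φ = σ ∘ ψ`, then there exist genuine
parametrizations (continuous, strictly increasing, surjective) `φ̂, ψ̂` with
`γ ∘ φ̂ = σ ∘ ψ̂`. -/
theorem exists_strict_params_of_monotone_factor {X : Type*} [MetricSpace X]
    (γ σ : ℝ → X) (φ ψ : ℝ → ℝ)
    (hγc : ContinuousOn γ (Icc 0 1)) (hσc : ContinuousOn σ (Icc 0 1))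
    (hγn : NowhereConstantOn γ 0 1) (hσn : NowhereConstantOn σ 0 1)
    (hφc : ContinuousOn φ (Icc 0 1)) (hψc : ContinuousOn ψ (Icc 0 1))
    (hφm : MonotoneOn φ (Icc 0 1)) (hψm : MonotoneOn ψ (Icc 0 1))
    (hφsurj : φ '' Icc 0 1 = Icc 0 1) (hψsurj : ψ '' Icc 0 1 = Icc 0 1)
    (hcomp : ∀ t ∈ Icc (0:ℝ) 1, γ (φ t) = σ (ψ t)) :
    ∃ φ' ψ' : ℝ → ℝ, IsParam φ' ∧ IsParam ψ' ∧
      ∀ t ∈ Icc (0:ℝ) 1, γ (φ' t) = σ (ψ' t) := by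
  have hφmaps : MapsTo φ (Icc 0 1) (Icc 0 1) := mapsTo_iff_image_subset.2 hφsurj.subset
  have hψmaps : MapsTo ψ (Icc 0 1) (Icc 0 1) := mapsTo_iff_image_subset.2 hψsurj.subset
  have hφψ {s t : ℝ} (hs : s ∈ Icc (0:ℝ) 1) (ht : t ∈ Icc (0:ℝ) 1) (h : φ s = φ t) :
      ψ s = ψ t := by
    rcases le_total s t with hst | hst
    · exact eq_of_monotone_factor_eq hσn hψc hφm hψm hψmaps hcomp hs ht hst h
    · exact (eq_of_monotone_factor_eq hσn hψc hφm hψm hψmaps hcomp ht hs hst h.symm).symm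
  have hinv : ∀ u ∈ Icc (0:ℝ) 1, ∃ t, t ∈ Icc (0:ℝ) 1 ∧ φ t = u :=
    fun u hu => hφsurj.superset hu
  choose! g hg hφg using hinv
  have hmono : StrictMonoOn (ψ ∘ g) (Icc 0 1) := by
    intro u hu v hv huv
    have hguv : g u ≤ g v := by
      by_contra! hlt
      have := hφm (hg _ hv) (hg _ hu) hlt.le
      rw [hφg _ hu, hφg _ hv] at this
      exact this.not_gt huv
    refine (hψm (hg _ hu) (hg _ hv) hguv).lt_of_ne fun heq => huv.ne ?_
    have := eq_of_monotone_factor_eq hγn hφc hψm hφm hφmaps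
      (fun t ht => (hcomp t ht).symm) (hg _ hu) (hg _ hv) hguv heq
    rwa [hφg _ hu, hφg _ hv] at this
  have himg : (ψ ∘ g) '' Icc 0 1 = Icc 0 1 := by
    refine Subset.antisymm (image_subset_iff.2 fun u hu => hψmaps (hg _ hu)) fun v hv => ?_
    obtain ⟨t, ht, rfl⟩ := hψsurj.superset hv
    exact ⟨φ t, hφmaps ht, hφψ (hg _ (hφmaps ht)) ht (hφg _ (hφmaps ht))⟩
  refine ⟨id, ψ ∘ g, ⟨continuousOn_id, strictMono_id.strictMonoOn _, image_id _⟩,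
    ⟨hmono.monotoneOn.continuousOn_of_image_Icc himg, hmono, himg⟩, fun t ht => ?_⟩
  rw [Function.comp_apply, ← hcomp _ (hg _ ht), hφg _ ht, id]

end
end

section
/- Let (X,d,≪,≤,τ) be a finitely τ-measurable Lorentzian pre-length space, let γ ∈ TGeo(X) connect p = γ(0) to q = γ(1), and suppose there exists a timelike family F : U × V → TGeo(X) about γ that is continuous at γ. If there does not exist a unique timelike family continuous at γ, then p and q are symmetrically conjugate along γ. -/
open Set Filter Topology NNReal ENNReal

noncomputable section

/-- A Lorentzian pre-length space structure on a metric space `X`. -/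
structure LorentzianPreLengthSpace (X : Type*) [MetricSpace X] where
  chron : X → X → Prop
  causal : X → X → Prop
  tau : X → X → ℝ≥0∞
  chron_trans : Transitive chron
  causal_trans : Transitive causal
  causal_refl : Reflexive causal
  chron_imp_causal : ∀ {x y : X}, chron x y → causal x y
  tau_lsc : LowerSemicontinuous fun p : X × X => tau p.1 p.2
  tau_eq_zero : ∀ {x y : X}, ¬ causal x y → tau x y = 0
  chron_iff_pos : ∀ x y : X, chron x y ↔ 0 < tau x y
  rev_triangle : ∀ x y z : X, causal x y → causal y z → tau x y + tau y z ≤ tau x z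

variable {X : Type*} [MetricSpace X]

/-- A future-directed causal curve on `[a,b]`. -/
def IsCausalCurveOn (L : LorentzianPreLengthSpace X) (γ : ℝ → X) (a b : ℝ) : Prop :=
  (∃ K : ℝ≥0, LipschitzOnWith K γ (Icc a b)) ∧ NowhereConstantOn γ a b ∧
    ∀ s t : ℝ, a ≤ s → s < t → t ≤ b → L.causal (γ s) (γ t)

/-- A future-directed timelike curve on `[a,b]`. -/
def IsTimelikeCurveOn (L : LorentzianPreLengthSpace X) (γ : ℝ → X) (a b : ℝ) : Prop :=
  (∃ K : ℝ≥0, LipschitzOnWith K γ (Icc a b)) ∧ NowhereConstantOn γ a b ∧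
    ∀ s t : ℝ, a ≤ s → s < t → t ≤ b → L.chron (γ s) (γ t)

/-- The `τ`-length of a curve on `[a,b]`: the infimum over partitions
`a = t₀ < t₁ < ⋯ < t_N = b` of `Σᵢ τ(γ(tᵢ), γ(tᵢ₊₁))`. -/
def tauLength (L : LorentzianPreLengthSpace X) (γ : ℝ → X) (a b : ℝ) : ℝ≥0∞ :=
  sInf { s : ℝ≥0∞ | ∃ (N : ℕ) (t : ℕ → ℝ), 1 ≤ N ∧ t 0 = a ∧ t N = b ∧
    StrictMonoOn t (Set.Iic N) ∧
    s = ∑ i ∈ Finset.range N, L.tau (γ (t i)) (γ (t (i + 1))) }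

/-- A maximizer on `[a,b]`. -/
def IsMaximizerOn (L : LorentzianPreLengthSpace X) (γ : ℝ → X) (a b : ℝ) : Prop :=
  tauLength L γ a b = L.tau (γ a) (γ b)

/-- A geodesic on `[a,b]`: a causal curve each of whose points has a relative
neighborhood `[a',b'] ⊆ [a,b]` on which the curve is maximizing. -/
def IsGeodesicOn (L : LorentzianPreLengthSpace X) (γ : ℝ → X) (a b : ℝ) : Prop :=
  IsCausalCurveOn L γ a b ∧
    ∀ t : ℝ, a ≤ t → t ≤ b → ∃ a' b' : ℝ, a ≤ a' ∧ a' ≤ t ∧ t ≤ b' ∧ b' ≤ b ∧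
      (a' < t ∨ t = a) ∧ (t < b' ∨ t = b) ∧ IsMaximizerOn L γ a' b'

/-- Every causal curve has finite `τ`-length. -/
def FinitelyTauMeasurable (L : LorentzianPreLengthSpace X) : Prop :=
  ∀ (γ : ℝ → X) (a b : ℝ), a < b → IsCausalCurveOn L γ a b → tauLength L γ a b < ⊤

/-- The metric `d_Γ` combining Fréchet distance and `τ`-length difference. -/
def dGamma (L : LorentzianPreLengthSpace X) (γ σ : ℝ → X) : ℝ :=
  frechetDist γ σ + |(tauLength L γ 0 1).toReal - (tauLength L σ 0 1).toReal|

/-- `γ` (parametrized on `[0,1]`) represents an element of `TGeo(X)`. -/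
def InTGeo (L : LorentzianPreLengthSpace X) (γ : ℝ → X) : Prop :=
  IsTimelikeCurveOn L γ 0 1 ∧ IsGeodesicOn L γ 0 1


/-- Convergence of a sequence of paths with respect to the metric `d_Γ`. -/
def DGammaTendsto (L : LorentzianPreLengthSpace X) (γs : ℕ → ℝ → X) (γ : ℝ → X) : Prop :=
  Tendsto (fun i => dGamma L (γs i) γ) atTop (𝓝 0)

/-- `p` and `q` are symmetrically conjugate along `γ ∈ TGeo(X)`: there are `pᵢ → p`,
`qᵢ → q` and, for each `i`, two distinct timelike geodesics from `pᵢ` to `qᵢ`, both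
converging to `γ` with respect to `d_Γ`. -/
def SymmConjugate (L : LorentzianPreLengthSpace X) (γ : ℝ → X) (p q : X) : Prop :=
  ∃ (ps qs : ℕ → X) (γs σs : ℕ → ℝ → X),
    Tendsto ps atTop (𝓝 p) ∧ Tendsto qs atTop (𝓝 q) ∧
    (∀ i, InTGeo L (γs i) ∧ InTGeo L (σs i) ∧
      γs i 0 = ps i ∧ γs i 1 = qs i ∧ σs i 0 = ps i ∧ σs i 1 = qs i ∧
      ¬ PathEquiv (γs i) (σs i)) ∧
    DGammaTendsto L γs γ ∧ DGammaTendsto L σs γ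

/-- `F` is a timelike family about `γ` on `U × V`. -/
def IsTimelikeFamily (L : LorentzianPreLengthSpace X) (γ : ℝ → X) (U V : Set X)
    (F : X → X → ℝ → X) : Prop :=
  U ∈ 𝓝 (γ 0) ∧ V ∈ 𝓝 (γ 1) ∧
  (∀ p' ∈ U, ∀ q' ∈ V, L.chron p' q') ∧
  (∀ p' ∈ U, ∀ q' ∈ V, InTGeo L (F p' q') ∧ F p' q' 0 = p' ∧ F p' q' 1 = q') ∧
  PathEquiv (F (γ 0) (γ 1)) γ

/-- The family `F` is continuous (with respect to `d_Γ`) at `γ`, i.e. at `(γ 0, γ 1)`. -/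
def FamilyContinuousAt (L : LorentzianPreLengthSpace X) (γ : ℝ → X) (U V : Set X)
    (F : X → X → ℝ → X) : Prop :=
  ∀ ε > (0:ℝ), ∃ δ > (0:ℝ), ∀ p' ∈ U, ∀ q' ∈ V,
    dist p' (γ 0) < δ → dist q' (γ 1) < δ → dGamma L (F p' q') γ < ε

/-- The family `F` is continuous (with respect to `d_Γ`) about `γ`, i.e. on all of `U × V`. -/
def FamilyContinuousAbout (L : LorentzianPreLengthSpace X) (γ : ℝ → X) (U V : Set X)
    (F : X → X → ℝ → X) : Prop :=
  ∀ p ∈ U, ∀ q ∈ V, ∀ ε > (0:ℝ), ∃ δ > (0:ℝ), ∀ p' ∈ U, ∀ q' ∈ V,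
    dist p' p < δ → dist q' q < δ → dGamma L (F p' q') (F p q) < ε

/-- Two timelike families (defined on `U × V` resp. `U' × V'`) coincide, as maps into
`TGeo(X)`, on a product of neighborhoods `U'' × V''` of `(p, q)` inside the common domain. -/
def FamiliesAgreeNear (p q : X) (U V U' V' : Set X) (F F' : X → X → ℝ → X) : Prop :=
  ∃ U'' ∈ 𝓝 p, ∃ V'' ∈ 𝓝 q, U'' ⊆ U ∩ U' ∧ V'' ⊆ V ∩ V' ∧
    ∀ x ∈ U'', ∀ y ∈ V'', PathEquiv (F x y) (F' x y)

/-- There is a unique (germ of a) timelike family about `γ` that is continuous at `γ`. -/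
def UniqueContFamilyAt (L : LorentzianPreLengthSpace X) (γ : ℝ → X) : Prop :=
  (∃ U V F, IsTimelikeFamily L γ U V F ∧ FamilyContinuousAt L γ U V F) ∧
  (∀ U V F U' V' F', IsTimelikeFamily L γ U V F → FamilyContinuousAt L γ U V F →
    IsTimelikeFamily L γ U' V' F' → FamilyContinuousAt L γ U' V' F' →
    FamiliesAgreeNear (γ 0) (γ 1) U V U' V' F F')

/-- `γ` is embeddable: there is a timelike family about `γ` that is continuous at `γ`. -/
def Embeddable (L : LorentzianPreLengthSpace X) (γ : ℝ → X) : Prop :=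
  ∃ U V F, IsTimelikeFamily L γ U V F ∧ FamilyContinuousAt L γ U V F

theorem dGamma_nonneg {X : Type*} [MetricSpace X] (L : LorentzianPreLengthSpace X)
    (γ σ : ℝ → X) : 0 ≤ dGamma L γ σ := by
  refine add_nonneg (Real.sInf_nonneg ?_) (abs_nonneg _)
  rintro r ⟨φ, ψ, -, -, h⟩
  exact dist_nonneg.trans (h 0 ⟨le_rfl, zero_le_one⟩)

/-- A family continuous at `γ` turns converging endpoints into `d_Γ`-converging geodesics. -/
theorem FamilyContinuousAt.dGammaTendsto {X : Type*} [MetricSpace X]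
    {L : LorentzianPreLengthSpace X} {γ : ℝ → X} {U V : Set X} {F : X → X → ℝ → X}
    (hF : FamilyContinuousAt L γ U V F) {ps qs : ℕ → X}
    (hpU : ∀ i, ps i ∈ U) (hqV : ∀ i, qs i ∈ V)
    (hp : Tendsto ps atTop (𝓝 (γ 0))) (hq : Tendsto qs atTop (𝓝 (γ 1))) :
    DGammaTendsto L (fun i => F (ps i) (qs i)) γ := by
  refine Metric.tendsto_nhds.2 fun ε hε => ?_
  obtain ⟨δ, hδ, h⟩ := hF ε hε
  filter_upwards [Metric.tendsto_nhds.1 hp δ hδ, Metric.tendsto_nhds.1 hq δ hδ] with i hi hi'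
  rw [Real.dist_0_eq_abs, abs_of_nonneg (dGamma_nonneg L _ _)]
  exact h _ (hpU i) _ (hqV i) hi hi'

/-- Families on neighborhoods of `p` and `q` that do not agree near `(p, q)` differ along a
sequence of endpoints converging to `(p, q)`. -/
theorem exists_seq_of_not_familiesAgreeNear {X : Type*} [MetricSpace X] {p q : X}
    {U V U' V' : Set X} {F F' : X → X → ℝ → X}
    (hU : U ∈ 𝓝 p) (hV : V ∈ 𝓝 q) (hU' : U' ∈ 𝓝 p) (hV' : V' ∈ 𝓝 q)
    (h : ¬ FamiliesAgreeNear p q U V U' V' F F') :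
    ∃ ps qs : ℕ → X, Tendsto ps atTop (𝓝 p) ∧ Tendsto qs atTop (𝓝 q) ∧
      ∀ i, ps i ∈ U ∩ U' ∧ qs i ∈ V ∩ V' ∧ ¬ PathEquiv (F (ps i) (qs i)) (F' (ps i) (qs i)) := by
  have key : ∃ᶠ z in 𝓝 (p, q), z.1 ∈ U ∩ U' ∧ z.2 ∈ V ∩ V' ∧
      ¬ PathEquiv (F z.1 z.2) (F' z.1 z.2) := by
    intro hev
    rw [nhds_prod_eq, Filter.eventually_prod_iff] at hev
    obtain ⟨P, hP, Q, hQ, hPQ⟩ := hev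
    refine h ⟨{x | P x} ∩ (U ∩ U'), inter_mem hP (inter_mem hU hU'),
      {y | Q y} ∩ (V ∩ V'), inter_mem hQ (inter_mem hV hV'),
      inter_subset_right, inter_subset_right, fun x hx y hy => ?_⟩
    by_contra hne
    exact hPQ hx.1 hy.1 ⟨hx.2, hy.2, hne⟩
  obtain ⟨z, hz, hz'⟩ := Filter.exists_seq_forall_of_frequently key
  rw [nhds_prod_eq] at hz
  exact ⟨fun i => (z i).1, fun i => (z i).2, tendsto_fst.comp hz, tendsto_snd.comp hz, hz'⟩

/-- If there exists a timelike family about `γ ∈ TGeo(X)` continuous at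
`γ`, but no unique timelike family continuous at `γ`, then the endpoints of `γ` are
symmetrically conjugate along `γ`. -/
theorem symmConjugate_of_not_uniqueContFamily
    {X : Type*} [MetricSpace X] (L : LorentzianPreLengthSpace X)
    (hfin : FinitelyTauMeasurable L)
    (γ : ℝ → X) (hγ : InTGeo L γ) (p q : X) (hp : γ 0 = p) (hq : γ 1 = q)
    (U V : Set X) (F : X → X → ℝ → X)
    (hF : IsTimelikeFamily L γ U V F) (hFc : FamilyContinuousAt L γ U V F)
    (hnon : ¬ UniqueContFamilyAt L γ) :
    SymmConjugate L γ p q := by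
  subst hp hq
  have hne : ∃ U V F U' V' F', IsTimelikeFamily L γ U V F ∧ FamilyContinuousAt L γ U V F ∧
      IsTimelikeFamily L γ U' V' F' ∧ FamilyContinuousAt L γ U' V' F' ∧
      ¬ FamiliesAgreeNear (γ 0) (γ 1) U V U' V' F F' := by
    by_contra! hall
    exact hnon ⟨⟨U, V, F, hF, hFc⟩, hall⟩
  obtain ⟨U₁, V₁, F₁, U₂, V₂, F₂, ⟨hU₁, hV₁, -, hF₁, -⟩, hc₁, ⟨hU₂, hV₂, -, hF₂, -⟩, hc₂, hdis⟩ :=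
    hne
  obtain ⟨ps, qs, hps, hqs, h⟩ := exists_seq_of_not_familiesAgreeNear hU₁ hV₁ hU₂ hV₂ hdis
  refine ⟨ps, qs, fun i => F₁ (ps i) (qs i), fun i => F₂ (ps i) (qs i), hps, hqs, fun i => ?_,
    hc₁.dGammaTendsto (fun i => (h i).1.1) (fun i => (h i).2.1.1) hps hqs,
    hc₂.dGammaTendsto (fun i => (h i).1.2) (fun i => (h i).2.1.2) hps hqs⟩
  obtain ⟨hp, hq, hne⟩ := h i
  obtain ⟨hg₁, hs₁, he₁⟩ := hF₁ _ hp.1 _ hq.1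
  obtain ⟨hg₂, hs₂, he₂⟩ := hF₂ _ hp.2 _ hq.2
  exact ⟨hg₁, hg₂, hs₁, he₁, hs₂, he₂, hne⟩

end
end

section
/- Let (X,d,≪,≤,τ) be a finitely τ-measurable Lorentzian pre-length space and let γ ∈ TGeo(X) connect p = γ(0) to q = γ(1). If p and q are not symmetrically conjugate along γ and there exists a timelike family F : U × V → TGeo(X) about γ that is continuous at γ, then the germ of F at (p,q) is the unique germ of a timelike family continuous at γ, i.e., every timelike family about γ continuous at γ coincides with F on U'' × V'' for some neighborhoods U'' of p and V'' of q. -/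
open Set Filter Topology NNReal ENNReal

noncomputable section

variable {X : Type*} [MetricSpace X]

/-- The Fréchet distance is nonnegative. -/
theorem frechetDist_nonneg {X : Type*} [MetricSpace X] (γ σ : ℝ → X) : 0 ≤ frechetDist γ σ := by
  refine Real.sInf_nonneg ?_
  rintro r ⟨φ, ψ, -, -, h⟩
  exact dist_nonneg.trans (h 0 ⟨le_rfl, zero_le_one⟩)

/-- If the endpoints of `γ ∈ TGeo(X)` are not symmetrically conjugate
along `γ` and `F` is a timelike family about `γ` continuous at `γ`, then the germ of `F`
at the endpoints is the unique germ of a timelike family continuous at `γ`. -/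
theorem unique_germ_of_not_symmConjugate
    {X : Type*} [MetricSpace X] (L : LorentzianPreLengthSpace X)
    (hfin : FinitelyTauMeasurable L)
    (γ : ℝ → X) (hγ : InTGeo L γ) (p q : X) (hp : γ 0 = p) (hq : γ 1 = q)
    (hnsc : ¬ SymmConjugate L γ p q)
    (U V : Set X) (F : X → X → ℝ → X)
    (hF : IsTimelikeFamily L γ U V F) (hFc : FamilyContinuousAt L γ U V F) :
    ∀ (U' V' : Set X) (F' : X → X → ℝ → X),
      IsTimelikeFamily L γ U' V' F' → FamilyContinuousAt L γ U' V' F' →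
      FamiliesAgreeNear p q U V U' V' F F' := by
  subst hp hq
  intro U' V' F' hF' hFc'
  by_contra hne
  have key : ∀ n : ℕ, ∃ z : X × X,
      z.1 ∈ (U ∩ U') ∩ Metric.ball (γ 0) (1 / ((n : ℝ) + 1)) ∧
      z.2 ∈ (V ∩ V') ∩ Metric.ball (γ 1) (1 / ((n : ℝ) + 1)) ∧
      ¬ PathEquiv (F z.1 z.2) (F' z.1 z.2) := by
    intro n
    by_contra! h
    have hr : (0 : ℝ) < 1 / ((n : ℝ) + 1) := by positivity
    exact hne ⟨_, inter_mem (inter_mem hF.1 hF'.1) (Metric.ball_mem_nhds _ hr),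
      _, inter_mem (inter_mem hF.2.1 hF'.2.1) (Metric.ball_mem_nhds _ hr),
      inter_subset_left, inter_subset_left, fun x hx y hy => h (x, y) hx hy⟩
  choose z hz₁ hz₂ hz using key
  have hlim : Tendsto (fun n : ℕ => 1 / ((n : ℝ) + 1)) atTop (𝓝 0) :=
    tendsto_one_div_add_atTop_nhds_zero_nat
  have hps : Tendsto (fun n => (z n).1) atTop (𝓝 (γ 0)) :=
    tendsto_iff_dist_tendsto_zero.2
      (squeeze_zero (fun _ => dist_nonneg) (fun n => (Metric.mem_ball.1 (hz₁ n).2).le) hlim)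
  have hqs : Tendsto (fun n => (z n).2) atTop (𝓝 (γ 1)) :=
    tendsto_iff_dist_tendsto_zero.2
      (squeeze_zero (fun _ => dist_nonneg) (fun n => (Metric.mem_ball.1 (hz₂ n).2).le) hlim)
  refine hnsc ⟨_, _, fun n => F (z n).1 (z n).2, fun n => F' (z n).1 (z n).2, hps, hqs,
    fun n => ?_,
    hFc.dGammaTendsto (fun n => (hz₁ n).1.1) (fun n => (hz₂ n).1.1) hps hqs,
    hFc'.dGammaTendsto (fun n => (hz₁ n).1.2) (fun n => (hz₂ n).1.2) hps hqs⟩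
  obtain ⟨hG, h0, h1⟩ := hF.2.2.2.1 _ (hz₁ n).1.1 _ (hz₂ n).1.1
  obtain ⟨hG', h0', h1'⟩ := hF'.2.2.2.1 _ (hz₁ n).1.2 _ (hz₂ n).1.2
  exact ⟨hG, hG', h0, h1, h0', h1', hz n⟩

end
end
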